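/- (Weak Gronwall lemma) Let f ∈ L¹(0,T), a ≥ 0 a constant, and b ∈ L¹(0,T) nonnegative, such that for every nonnegative ξ ∈ C_c^∞(0,T) one has −∫₀ᵀ ξ'(s) f(s) ds ≤ ∫₀ᵀ ξ(s)(a·f(s) + b(s)) ds. Then for almost all 0 ≤ s < t < T, f(t) ≤ f(s)·e^{a(t−s)} + ∫ₛᵗ e^{a(t−τ)} b(τ) dτ. -/

import Mathlib

open MeasureTheory Set Filter Topology

/-- The mollification of the indicator function of `[s, t]` by a bump function `φ`. -/
noncomputable def mollifiedIndicator (φ : ContDiffBump (0 : ℝ)) (s t x : ℝ) : ℝ :=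
  ∫ y in (x - t)..(x - s), φ.normed volume y

namespace mollifiedIndicator

variable (φ : ContDiffBump (0 : ℝ)) {s t : ℝ}

theorem hasDerivAt (s t x : ℝ) :
    HasDerivAt (mollifiedIndicator φ s t)
      (φ.normed volume (x - s) - φ.normed volume (x - t)) x := by
  have hprim (u : ℝ) : HasDerivAt (fun x => ∫ y in (0 : ℝ)..x, φ.normed volume y)
      (φ.normed volume u) u :=
    φ.continuous_normed.integral_hasStrictDerivAt 0 u |>.hasDerivAt
  have hsub : mollifiedIndicator φ s t = fun x =>
      (∫ y in (0 : ℝ)..(x - s), φ.normed volume y) -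
        ∫ y in (0 : ℝ)..(x - t), φ.normed volume y := by
    ext x
    exact (intervalIntegral.integral_interval_sub_left
      (φ.continuous_normed.intervalIntegrable _ _)
      (φ.continuous_normed.intervalIntegrable _ _)).symm
  rw [hsub]
  exact ((hprim (x - s)).comp_sub_const x s).sub ((hprim (x - t)).comp_sub_const x t)

theorem deriv_eq (s t : ℝ) : deriv (mollifiedIndicator φ s t) =
    fun x => φ.normed volume (x - s) - φ.normed volume (x - t) :=
  funext fun x => (hasDerivAt φ s t x).deriv

theorem contDiff (s t : ℝ) : ContDiff ℝ (⊤ : ℕ∞) (mollifiedIndicator φ s t) := by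
  have hφ : ContDiff ℝ (⊤ : ℕ∞) (φ.normed volume) := φ.contDiff_normed
  refine contDiff_infty_iff_deriv.2 ⟨fun x => (hasDerivAt φ s t x).differentiableAt, ?_⟩
  rw [deriv_eq]
  exact (hφ.comp (contDiff_id.sub contDiff_const)).sub (hφ.comp (contDiff_id.sub contDiff_const))

theorem nonneg (hst : s ≤ t) (x : ℝ) : 0 ≤ mollifiedIndicator φ s t x :=
  intervalIntegral.integral_nonneg (by linarith) fun y _ => φ.nonneg_normed y

theorem le_one (hst : s ≤ t) (x : ℝ) : mollifiedIndicator φ s t x ≤ 1 := by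
  rw [mollifiedIndicator, intervalIntegral.integral_of_le (by linarith),
    ← φ.integral_normed (μ := volume)]
  exact setIntegral_le_integral φ.integrable_normed (ae_of_all _ φ.nonneg_normed)

theorem support_subset (hst : s ≤ t) :
    Function.support (mollifiedIndicator φ s t) ⊆ Ioc (s - φ.rOut) (t + φ.rOut) := by
  intro x hx
  by_contra hout
  refine hx ((intervalIntegral.integral_congr fun y hy => ?_).trans
    intervalIntegral.integral_zero)
  rw [uIcc_of_le (by linarith)] at hy
  refine Function.notMem_support.1 fun hmem => hout ?_
  rw [φ.support_normed_eq, Metric.mem_ball, Real.dist_eq, sub_zero, abs_lt] at hmem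
  exact ⟨by linarith [hy.2, hmem.1], by linarith [hy.1, hmem.2]⟩

theorem hasCompactSupport (hst : s ≤ t) : HasCompactSupport (mollifiedIndicator φ s t) :=
  HasCompactSupport.of_support_subset_isCompact isCompact_Icc
    ((support_subset φ hst).trans Ioc_subset_Icc_self)

open scoped Convolution in
theorem neg_integral_deriv_mul {G : ℝ → ℝ} (hG : Integrable G) (s t : ℝ) :
    -∫ x, deriv (mollifiedIndicator φ s t) x * G x =
      (φ.normed volume ⋆[ContinuousLinearMap.lsmul ℝ ℝ, volume] G) t -
        (φ.normed volume ⋆[ContinuousLinearMap.lsmul ℝ ℝ, volume] G) s := by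
  have hconv (u : ℝ) : (φ.normed volume ⋆[ContinuousLinearMap.lsmul ℝ ℝ, volume] G) u =
      ∫ x, φ.normed volume (x - u) * G x := by
    rw [convolution_lsmul_swap]
    refine integral_congr_ae (ae_of_all _ fun x => ?_)
    simp only [smul_eq_mul]
    rw [← φ.normed_neg, neg_sub]
  obtain ⟨C, hC⟩ := φ.hasCompactSupport_normed (μ := volume) |>.exists_bound_of_continuous
    φ.continuous_normed
  have hint (u : ℝ) : Integrable fun x => φ.normed volume (x - u) * G x :=
    hG.bdd_mul (c := C)
      (φ.continuous_normed.comp (continuous_id.sub continuous_const)).aestronglyMeasurable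
      (ae_of_all _ fun x => hC (x - u))
  simp only [deriv_eq, sub_mul]
  rw [integral_sub (hint s) (hint t), hconv, hconv, neg_sub]

end mollifiedIndicator

/-- If `g' ≤ c` on `(0, T)` in the sense of distributions, with `c` nonnegative, then
`g t - g s ≤ ∫ τ in s..t, c τ` for all `s < t` outside a null set. -/
theorem exists_ae_sub_le_integral_of_distributional_le {T : ℝ} {g c : ℝ → ℝ}
    (hg : IntegrableOn g (Ioo 0 T)) (hc : IntegrableOn c (Ioo 0 T))
    (hc0 : ∀ s ∈ Ioo (0 : ℝ) T, 0 ≤ c s)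
    (h : ∀ η : ℝ → ℝ, ContDiff ℝ (⊤ : ℕ∞) η → HasCompactSupport η →
      Function.support η ⊆ Ioo 0 T → (∀ s, 0 ≤ η s) →
      -∫ s in Ioo 0 T, deriv η s * g s ≤ ∫ s in Ioo 0 T, η s * c s) :
    ∃ P : ℝ → Prop, (∀ᵐ x, P x) ∧ ∀ s t, P s → P t → 0 < s → s < t → t < T →
      g t - g s ≤ ∫ τ in Ioo s t, c τ := by
  set G := (Ioo 0 T).indicator g
  set C := (Ioo 0 T).indicator c
  have hG : Integrable G := hg.integrable_indicator measurableSet_Ioo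
  have hC : Integrable C := hc.integrable_indicator measurableSet_Ioo
  have hC0 (x : ℝ) : 0 ≤ C x := indicator_nonneg hc0 x
  let φ : ℕ → ContDiffBump (0 : ℝ) := fun n =>
    ⟨1 / ((n : ℝ) + 1), 2 * (1 / ((n : ℝ) + 1)), by positivity, by
      have : 0 < 1 / ((n : ℝ) + 1) := by positivity
      linarith⟩
  have hφ : Tendsto (fun n => (φ n).rOut) atTop (𝓝 0) := by
    simpa [φ] using tendsto_one_div_add_atTop_nhds_zero_nat.const_mul (2 : ℝ)
  refine ⟨_, ContDiffBump.ae_convolution_tendsto_right_of_locallyIntegrable (K := 2) hφ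
    (Eventually.of_forall fun n => le_rfl) hG.locallyIntegrable, ?_⟩
  intro s t hs ht h0s hst htT
  have hcont : Continuous fun x => ∫ τ in (0 : ℝ)..x, C τ :=
    intervalIntegral.continuous_primitive (fun _ _ => hC.intervalIntegrable) 0
  have hlim : Tendsto (fun n => (∫ τ in (0 : ℝ)..(t + (φ n).rOut), C τ) -
      ∫ τ in (0 : ℝ)..(s - (φ n).rOut), C τ) atTop
      (𝓝 ((∫ τ in (0 : ℝ)..t, C τ) - ∫ τ in (0 : ℝ)..s, C τ)) := by
    refine ((hcont.tendsto t).comp ?_).sub ((hcont.tendsto s).comp ?_)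
    · simpa using hφ.const_add t
    · simpa using hφ.const_sub s
  have hsmall : ∀ᶠ n in atTop, (φ n).rOut < min s (T - t) :=
    hφ.eventually_lt_const (lt_min h0s (by linarith))
  have hle := le_of_tendsto_of_tendsto (ht.sub hs) hlim <| by
    filter_upwards [hsmall] with n hn
    have hsupp : Ioc (s - (φ n).rOut) (t + (φ n).rOut) ⊆ Ioo 0 T := fun x hx =>
      ⟨by linarith [hx.1, min_le_left s (T - t)], by linarith [hx.2, min_le_right s (T - t)]⟩
    have key := h _ (mollifiedIndicator.contDiff (φ n) s t)
      (mollifiedIndicator.hasCompactSupport (φ n) hst.le)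
      ((mollifiedIndicator.support_subset (φ n) hst.le).trans hsupp)
      (mollifiedIndicator.nonneg (φ n) hst.le)
    have hpush (u v : ℝ → ℝ) : ∫ x in Ioo 0 T, u x * v x =
        ∫ x, u x * (Ioo 0 T).indicator v x := by
      rw [← integral_indicator measurableSet_Ioo]
      simp only [indicator_mul_right]
    rw [hpush, hpush, mollifiedIndicator.neg_integral_deriv_mul (φ n) hG] at key
    refine key.trans ?_
    rw [intervalIntegral.integral_interval_sub_left hC.intervalIntegrable hC.intervalIntegrable,
      intervalIntegral.integral_of_le (by linarith [(φ n).rOut_pos]),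
      ← integral_indicator measurableSet_Ioc]
    refine integral_mono_of_nonneg
      (ae_of_all _ fun x => mul_nonneg (mollifiedIndicator.nonneg (φ n) hst.le x) (hC0 x))
      (hC.indicator measurableSet_Ioc) (ae_of_all _ fun x => ?_)
    by_cases hx : x ∈ Ioc (s - (φ n).rOut) (t + (φ n).rOut)
    · rw [indicator_of_mem hx]
      exact mul_le_of_le_one_left (hC0 x) (mollifiedIndicator.le_one (φ n) hst.le x)
    · have hzero : mollifiedIndicator (φ n) s t x = 0 :=
        Function.notMem_support.1 fun hmem =>
          hx (mollifiedIndicator.support_subset (φ n) hst.le hmem)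
      simp [hzero, indicator_of_notMem hx]
  have hsT : s ∈ Ioo 0 T := ⟨h0s, hst.trans htT⟩
  have htT' : t ∈ Ioo 0 T := ⟨h0s.trans hst, htT⟩
  have hGs : G s = g s := indicator_of_mem hsT g
  have hGt : G t = g t := indicator_of_mem htT' g
  rw [hGs, hGt,
    intervalIntegral.integral_interval_sub_left hC.intervalIntegrable hC.intervalIntegrable,
    intervalIntegral.integral_of_le hst.le, integral_Ioc_eq_integral_Ioo] at hle
  refine hle.trans_eq (setIntegral_congr_fun measurableSet_Ioo fun x hx => ?_)
  exact indicator_of_mem (show x ∈ Ioo 0 T from ⟨h0s.trans hx.1, hx.2.trans htT⟩) c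

theorem MeasureTheory.IntegrableOn.continuous_mul_Ioo {x y : ℝ} {u v : ℝ → ℝ}
    (hv : IntegrableOn v (Ioo x y)) (hu : Continuous u) :
    IntegrableOn (fun z => u z * v z) (Ioo x y) := by
  rw [← integrableOn_Icc_iff_integrableOn_Ioo] at hv ⊢
  exact hv.continuousOn_mul hu.continuousOn isCompact_Icc

/-- Weak Gronwall lemma: if `f ∈ L¹(0,T)` satisfies the distributional inequality
`f' ≤ a f + b` on `(0,T)` (tested against nonnegative `ξ ∈ C_c^∞(0,T)`), then for
almost all `0 ≤ s < t < T` one has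
`f t ≤ f s * exp (a (t - s)) + ∫_s^t exp (a (t - τ)) b τ dτ`. -/
theorem stmt3 (T a : ℝ) (ha : 0 ≤ a) (f b : ℝ → ℝ)
    (hf : IntegrableOn f (Ioo 0 T))
    (hb : IntegrableOn b (Ioo 0 T))
    (hbnn : ∀ s ∈ Ioo (0:ℝ) T, 0 ≤ b s)
    (hineq : ∀ ξ : ℝ → ℝ, ContDiff ℝ (⊤ : ℕ∞) ξ → HasCompactSupport ξ →
      Function.support ξ ⊆ Ioo 0 T → (∀ s, 0 ≤ ξ s) →
      -∫ s in Ioo 0 T, deriv ξ s * f s ≤ ∫ s in Ioo 0 T, ξ s * (a * f s + b s)) :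
    ∀ᵐ p : ℝ × ℝ ∂volume, (0 ≤ p.1 ∧ p.1 < p.2 ∧ p.2 < T) →
      f p.2 ≤ f p.1 * Real.exp (a * (p.2 - p.1)) +
        ∫ τ in Ioo p.1 p.2, Real.exp (a * (p.2 - τ)) * b τ := by
  have hE : ContDiff ℝ (⊤ : ℕ∞) fun x : ℝ => Real.exp (-a * x) := by fun_prop
  have hE' (x : ℝ) : HasDerivAt (fun x : ℝ => Real.exp (-a * x)) (-a * Real.exp (-a * x)) x := by
    simpa [mul_comm] using ((hasDerivAt_id x).const_mul (-a)).exp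
  obtain ⟨P, hP, hmain⟩ := exists_ae_sub_le_integral_of_distributional_le
    (hf.continuous_mul_Ioo hE.continuous) (hb.continuous_mul_Ioo hE.continuous)
    (fun s hs => mul_nonneg (Real.exp_pos _).le (hbnn s hs)) <| by
      intro η hη hηc hηs hη0
      have key := hineq (fun x => Real.exp (-a * x) * η x) (hE.mul hη) hηc.mul_left
        ((Function.support_mul_subset_right _ _).trans hηs)
        (fun x => mul_nonneg (Real.exp_pos _).le (hη0 x))
      have hderiv : deriv (fun x => Real.exp (-a * x) * η x) = fun x =>
          -a * Real.exp (-a * x) * η x + Real.exp (-a * x) * deriv η x :=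
        funext fun x => ((hE' x).mul (hη.differentiable (by simp) x).hasDerivAt).deriv
      have hη'c : Continuous (deriv η) := hη.continuous_deriv (by simp)
      have hηcont := hη.continuous
      have i1 : IntegrableOn (fun x => deriv η x * (Real.exp (-a * x) * f x)) (Ioo 0 T) :=
        (hf.continuous_mul_Ioo hE.continuous).continuous_mul_Ioo hη'c
      have i2 : IntegrableOn (fun x => a * (η x * (Real.exp (-a * x) * f x))) (Ioo 0 T) :=
        ((hf.continuous_mul_Ioo hE.continuous).continuous_mul_Ioo hηcont).const_mul a
      have i3 : IntegrableOn (fun x => η x * (Real.exp (-a * x) * b x)) (Ioo 0 T) :=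
        (hb.continuous_mul_Ioo hE.continuous).continuous_mul_Ioo hηcont
      have e1 : ∫ x in Ioo 0 T, deriv (fun x => Real.exp (-a * x) * η x) x * f x =
          (∫ x in Ioo 0 T, deriv η x * (Real.exp (-a * x) * f x)) -
            ∫ x in Ioo 0 T, a * (η x * (Real.exp (-a * x) * f x)) := by
        rw [← integral_sub i1 i2, hderiv]
        congr 1 with x
        ring
      have e2 : ∫ x in Ioo 0 T, Real.exp (-a * x) * η x * (a * f x + b x) =
          (∫ x in Ioo 0 T, a * (η x * (Real.exp (-a * x) * f x))) +
            ∫ x in Ioo 0 T, η x * (Real.exp (-a * x) * b x) := by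
        rw [← integral_add i2 i3]
        congr 1 with x
        ring
      linarith
  have hfst : ∀ᵐ p : ℝ × ℝ, P p.1 ∧ p.1 ≠ 0 :=
    Measure.quasiMeasurePreserving_fst.ae (hP.and (Measure.ae_ne volume 0))
  have hsnd : ∀ᵐ p : ℝ × ℝ, P p.2 := Measure.quasiMeasurePreserving_snd.ae hP
  filter_upwards [hfst, hsnd] with ⟨s, t⟩ ⟨hPs, hs0⟩ hPt ⟨h0s, hst, htT⟩
  have key := mul_le_mul_of_nonneg_left
    (hmain s t hPs hPt (lt_of_le_of_ne h0s hs0.symm) hst htT) (Real.exp_pos (a * t)).le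
  rw [← integral_const_mul] at key
  have hexp (x : ℝ) : Real.exp (a * (t - x)) = Real.exp (a * t) * Real.exp (-a * x) := by
    rw [← Real.exp_add]
    ring_nf
  have hexp_self : Real.exp (a * t) * Real.exp (-a * t) = 1 := by
    rw [← hexp, sub_self, mul_zero, Real.exp_zero]
  have hint : ∫ τ in Ioo s t, Real.exp (a * (t - τ)) * b τ =
      ∫ τ in Ioo s t, Real.exp (a * t) * (Real.exp (-a * τ) * b τ) := by
    simp only [hexp, mul_assoc]
  dsimp only
  rw [hint, hexp]
  linear_combination key - f t * hexp_self
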